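/- Let (B, Θ) be a C*-dynamical system over ℝ^d equipped with a covariant C(T)-algebra structure. Then the linear span of {φ • b : φ ∈ C₀(T), b ∈ B^∞} is dense in B^∞ for the Fréchet topology of B^∞: for every f ∈ B^∞, every k ∈ ℕ and every ε > 0 there exists g in that linear span such that ‖δ^μ(f − g)‖_B ≤ ε for every multi-index μ ∈ ℕ^d with |μ| ≤ k. In particular, the linear span of {φ • b : φ ∈ C₀(T), b ∈ B^∞} is dense in B in the norm topology. -/

import Mathlib

open ZeroAtInfty

/-- A `C(T)`-algebra structure on a C*-algebra `B`: a nondegenerate injective bilinear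
action `(φ, b) ↦ φ • b` of `C₀(T, ℂ)` on `B` by central multipliers. -/
structure CTAlgebraStructure (T : Type*) [TopologicalSpace T]
    (B : Type*) [NonUnitalCStarAlgebra B] where
  smul : C₀(T, ℂ) → B → B
  add_left : ∀ (φ ψ : C₀(T, ℂ)) (b : B), smul (φ + ψ) b = smul φ b + smul ψ b
  smul_left : ∀ (c : ℂ) (φ : C₀(T, ℂ)) (b : B), smul (c • φ) b = c • smul φ b
  add_right : ∀ (φ : C₀(T, ℂ)) (a b : B), smul φ (a + b) = smul φ a + smul φ b
  smul_right : ∀ (c : ℂ) (φ : C₀(T, ℂ)) (b : B), smul φ (c • b) = c • smul φ b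
  mul_smul : ∀ (φ ψ : C₀(T, ℂ)) (b : B), smul φ (smul ψ b) = smul (φ * ψ) b
  smul_mul_left : ∀ (φ : C₀(T, ℂ)) (a b : B), smul φ (a * b) = smul φ a * b
  smul_mul_right : ∀ (φ : C₀(T, ℂ)) (a b : B), smul φ (a * b) = a * smul φ b
  star_smul : ∀ (φ : C₀(T, ℂ)) (b : B), star (smul φ b) = smul (star φ) (star b)
  norm_smul_le : ∀ (φ : C₀(T, ℂ)) (b : B), ‖smul φ b‖ ≤ ‖φ‖ * ‖b‖
  nondegenerate :
    Dense ((Submodule.span ℂ {x : B | ∃ φ b, x = smul φ b} : Submodule ℂ B) : Set B)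
  injective : ∀ φ : C₀(T, ℂ), (∀ b : B, smul φ b = 0) → φ = 0

/-- The set of smooth vectors of an action `Θ` of `ℝ^d` on a C*-algebra `B`. -/
def smoothVectors {B : Type*} [NonUnitalCStarAlgebra B] {d : ℕ}
    (Θ : (Fin d → ℝ) → B ≃⋆ₐ[ℂ] B) : Set B :=
  {f : B | ContDiff ℝ (⊤ : ℕ∞) fun X : Fin d → ℝ => Θ X f}

/-- Partial derivative of a function on `ℝ^d` in the `j`-th standard coordinate direction. -/
noncomputable def coordDeriv {d : ℕ} {E : Type*} [NormedAddCommGroup E] [NormedSpace ℝ E]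
    (j : Fin d) (F : (Fin d → ℝ) → E) : (Fin d → ℝ) → E :=
  fun X => fderiv ℝ F X (Pi.single j 1)

/-- Iterated partial derivatives along a list of coordinate directions. -/
noncomputable def multiDeriv {d : ℕ} {E : Type*} [NormedAddCommGroup E] [NormedSpace ℝ E] :
    List (Fin d) → ((Fin d → ℝ) → E) → ((Fin d → ℝ) → E)
  | [], F => F
  | j :: L, F => multiDeriv L (coordDeriv j F)

/-- The list of coordinate directions determined by a multi-index `μ ∈ ℕ^d`. -/
def multiIndexList {d : ℕ} (μ : Fin d → ℕ) : List (Fin d) :=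
  (List.finRange d).flatMap fun j => List.replicate (μ j) j

open Filter Topology MeasureTheory

namespace CTAlgebraStructure

variable {T : Type*} [TopologicalSpace T] {B : Type*} [NonUnitalCStarAlgebra B]

/-- The action of a fixed function in a `C(T)`-algebra structure, as a bounded operator. -/
noncomputable def smulCLM (S : CTAlgebraStructure T B) (φ : C₀(T, ℂ)) : B →L[ℂ] B :=
  LinearMap.mkContinuous
    { toFun := S.smul φ
      map_add' := S.add_right φ
      map_smul' := fun c b => S.smul_right c φ b } ‖φ‖ (S.norm_smul_le φ)

@[simp]
lemma smulCLM_apply (S : CTAlgebraStructure T B) (φ : C₀(T, ℂ)) (b : B) :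
    S.smulCLM φ b = S.smul φ b := rfl

/-- An approximate unit of `C₀(T)` acts on a `C(T)`-algebra as an approximate unit. -/
lemma tendsto_smul_of_isApproximateUnit (S : CTAlgebraStructure T B) {l : Filter C₀(T, ℂ)}
    (hl : l.IsApproximateUnit) (hnorm : ∀ᶠ φ in l, ‖φ‖ ≤ 1) (b : B) :
    Tendsto (fun φ => S.smul φ b) l (𝓝 b) := by
  have hspan : ∀ c ∈ Submodule.span ℂ {x : B | ∃ φ b, x = S.smul φ b},
      Tendsto (fun φ => S.smul φ c) l (𝓝 c) := by
    intro c hc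
    induction hc using Submodule.span_induction with
    | mem x hx =>
      obtain ⟨ψ, a, rfl⟩ := hx
      have hcontinuous : Continuous fun χ : C₀(T, ℂ) => S.smul χ a := by
        let A : C₀(T, ℂ) →ₗ[ℂ] B :=
          { toFun := fun χ => S.smul χ a
            map_add' := fun χ χ' => S.add_left χ χ' a
            map_smul' := fun z χ => S.smul_left z χ a }
        exact AddMonoidHomClass.continuous_of_bound A ‖a‖ fun χ => by
          rw [mul_comm]
          exact S.norm_smul_le χ a
      simp only [S.mul_smul]
      exact (hcontinuous.tendsto ψ).comp (hl.tendsto_mul_right ψ)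
    | zero => simpa only [← smulCLM_apply, map_zero] using tendsto_const_nhds
    | add x y _ _ hx hy => simpa only [S.add_right] using hx.add hy
    | smul z x _ hx => simpa only [S.smul_right] using hx.const_smul z
  rw [Metric.tendsto_nhds]
  intro ε hε
  obtain ⟨c, hc, hbc⟩ := S.nondegenerate.exists_dist_lt b (show 0 < ε / 3 by positivity)
  filter_upwards [hnorm, Metric.tendsto_nhds.1 (hspan c hc) (ε / 3) (by positivity)]
    with φ hφ hφc
  have hle : dist (S.smul φ b) (S.smul φ c) ≤ dist b c := by
    rw [dist_eq_norm, dist_eq_norm, ← smulCLM_apply, ← smulCLM_apply, ← map_sub, smulCLM_apply]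
    exact (S.norm_smul_le φ _).trans (mul_le_of_le_one_left (norm_nonneg _) hφ)
  have htri := dist_triangle4 (S.smul φ b) (S.smul φ c) c b
  rw [dist_comm c b] at htri
  linarith

/-- A finite family in a `C(T)`-algebra is approximately fixed by a single function. -/
lemma exists_norm_sub_smul_le (S : CTAlgebraStructure T B) {ι : Type*} {s : Set ι}
    (hs : s.Finite) (b : ι → B) {ε : ℝ} (hε : 0 < ε) :
    ∃ φ : C₀(T, ℂ), ∀ i ∈ s, ‖b i - S.smul φ (b i)‖ ≤ ε := by
  let _ := CStarAlgebra.spectralOrder C₀(T, ℂ)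
  have _ := CStarAlgebra.spectralOrderedRing C₀(T, ℂ)
  have hl := CStarAlgebra.increasingApproximateUnit C₀(T, ℂ)
  have hev : ∀ᶠ φ in CStarAlgebra.approximateUnit C₀(T, ℂ),
      ∀ i ∈ s, ‖b i - S.smul φ (b i)‖ ≤ ε := by
    rw [eventually_all_finite hs]
    intro i _
    filter_upwards [Metric.tendsto_nhds.1 (S.tendsto_smul_of_isApproximateUnit
      hl.toIsApproximateUnit hl.eventually_norm (b i)) ε hε] with φ hφ
    rw [← dist_eq_norm, dist_comm]
    exact hφ.le
  exact hev.exists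

end CTAlgebraStructure

lemma coordDeriv_clm_comp {d : ℕ} {E F : Type*} [NormedAddCommGroup E] [NormedSpace ℝ E]
    [NormedAddCommGroup F] [NormedSpace ℝ F] (L : E →L[ℝ] F) (j : Fin d)
    {G : (Fin d → ℝ) → E} (hG : Differentiable ℝ G) :
    coordDeriv j (fun X => L (G X)) = fun X => L (coordDeriv j G X) := by
  funext X
  have h := L.hasFDerivAt.comp X (hG X).hasFDerivAt
  exact congrArg (fun A : (Fin d → ℝ) →L[ℝ] F => A (Pi.single j 1)) h.fderiv

lemma contDiff_coordDeriv {d : ℕ} {E : Type*} [NormedAddCommGroup E] [NormedSpace ℝ E]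
    (j : Fin d) {G : (Fin d → ℝ) → E} (hG : ContDiff ℝ (⊤ : ℕ∞) G) :
    ContDiff ℝ (⊤ : ℕ∞) (coordDeriv j G) :=
  (hG.fderiv_right (m := (⊤ : ℕ∞)) le_rfl).clm_apply contDiff_const

lemma multiDeriv_clm_comp {d : ℕ} {E F : Type*} [NormedAddCommGroup E] [NormedSpace ℝ E]
    [NormedAddCommGroup F] [NormedSpace ℝ F] (L : E →L[ℝ] F) (l : List (Fin d))
    {G : (Fin d → ℝ) → E} (hG : ContDiff ℝ (⊤ : ℕ∞) G) :
    multiDeriv l (fun X => L (G X)) = fun X => L (multiDeriv l G X) := by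
  induction l generalizing G with
  | nil => rfl
  | cons j l ih =>
    rw [multiDeriv, multiDeriv, coordDeriv_clm_comp L j (hG.differentiable (by simp)),
      ih (contDiff_coordDeriv j hG)]

/-- Smooth vectors of a strongly continuous action of `ℝ^d` are norm dense. -/
lemma dense_smoothVectors {B : Type*} [NonUnitalCStarAlgebra B] {d : ℕ}
    (Θ : (Fin d → ℝ) → B ≃⋆ₐ[ℂ] B)
    (hadd : ∀ (X Y : Fin d → ℝ) (a : B), Θ (X + Y) a = Θ X (Θ Y a))
    (hzero : ∀ a : B, Θ 0 a = a)
    (hcont : ∀ a : B, Continuous fun X : Fin d → ℝ => Θ X a) :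
    Dense (smoothVectors Θ) := by
  intro b
  let ρ : ℕ → ContDiffBump (0 : Fin d → ℝ) := fun n =>
    ⟨1 / ((n : ℝ) + 1) / 2, 1 / ((n : ℝ) + 1), half_pos Nat.one_div_pos_of_nat,
      half_lt_self Nat.one_div_pos_of_nat⟩
  have hlim := ContDiffBump.convolution_tendsto_right_of_continuous (μ := volume) (φ := ρ)
    tendsto_one_div_add_atTop_nhds_zero_nat (hcont b) 0
  rw [hzero] at hlim
  refine mem_closure_of_tendsto hlim (Eventually.of_forall fun n => ?_)
  have hsmooth := (ρ n).hasCompactSupport_normed (μ := volume) |>.contDiff_convolution_left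
    (μ := volume) (n := ⊤) (ContinuousLinearMap.lsmul ℝ ℝ) (ρ n).contDiff_normed
    (hcont b).locallyIntegrable
  have hexists := (ρ n).hasCompactSupport_normed (μ := volume) |>.convolutionExists_left
    (μ := volume) (ContinuousLinearMap.lsmul ℝ ℝ) (ρ n).continuous_normed
    (hcont b).locallyIntegrable
  refine (congrArg (ContDiff ℝ (⊤ : ℕ∞)) (funext fun Y => ?_)).mp hsmooth
  let A : B →L[ℂ] B := LinearMap.mkContinuous ((Θ Y : B ≃⋆ₐ[ℂ] B) : B →ₗ[ℂ] B) 1 fun a => by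
    simpa using (NonUnitalStarAlgHom.norm_apply_le (Θ Y) a)
  have hcomm := (A.restrictScalars ℝ).integral_comp_comm (hexists 0)
  refine Eq.trans (integral_congr_ae (Eventually.of_forall fun t => ?_)) hcomm
  change (ρ n).normed volume t • Θ (Y - t) b
    = A.restrictScalars ℝ ((ρ n).normed volume t • Θ (0 - t) b)
  rw [map_smul, zero_sub, sub_eq_add_neg, hadd]
  rfl

/-- Let `(B, Θ)` be a C*-dynamical system over `ℝ^d` equipped with a covariant
`C(T)`-algebra structure.  Then the linear span of `{φ • b : φ ∈ C₀(T), b ∈ B^∞}` is dense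
in `B^∞` for the Fréchet topology of `B^∞`; in particular it is dense in `B` in the norm
topology. -/
theorem span_smul_smooth_dense
    {T : Type*} [TopologicalSpace T] [LocallyCompactSpace T] [T2Space T]
    {B : Type*} [NonUnitalCStarAlgebra B] {d : ℕ}
    (Θ : (Fin d → ℝ) → B ≃⋆ₐ[ℂ] B)
    (hadd : ∀ (X Y : Fin d → ℝ) (a : B), Θ (X + Y) a = Θ X (Θ Y a))
    (hzero : ∀ a : B, Θ 0 a = a)
    (hcont : ∀ a : B, Continuous fun X : Fin d → ℝ => Θ X a)
    (S : CTAlgebraStructure T B)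
    (hcov : ∀ (X : Fin d → ℝ) (φ : C₀(T, ℂ)) (b : B),
      Θ X (S.smul φ b) = S.smul φ (Θ X b)) :
    (∀ f ∈ smoothVectors Θ, ∀ k : ℕ, ∀ ε > (0 : ℝ),
      ∃ g ∈ Submodule.span ℂ
          {x : B | ∃ φ : C₀(T, ℂ), ∃ b ∈ smoothVectors Θ, x = S.smul φ b},
        ∀ μ : Fin d → ℕ, (∑ j, μ j) ≤ k →
          ‖multiDeriv (multiIndexList μ) (fun X => Θ X (f - g)) 0‖ ≤ ε) ∧
    Dense ((Submodule.span ℂ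
        {x : B | ∃ φ : C₀(T, ℂ), ∃ b ∈ smoothVectors Θ, x = S.smul φ b} :
          Submodule ℂ B) : Set B) := by
  have hfrechet : ∀ f ∈ smoothVectors Θ, ∀ k : ℕ, ∀ ε > (0 : ℝ),
      ∃ g ∈ Submodule.span ℂ
          {x : B | ∃ φ : C₀(T, ℂ), ∃ b ∈ smoothVectors Θ, x = S.smul φ b},
        ∀ μ : Fin d → ℕ, (∑ j, μ j) ≤ k →
          ‖multiDeriv (multiIndexList μ) (fun X => Θ X (f - g)) 0‖ ≤ ε := by
    intro f hf k ε hε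
    have hfin : {μ : Fin d → ℕ | ∑ j, μ j ≤ k}.Finite :=
      (Set.finite_Iic fun _ : Fin d => k).subset fun μ hμ j =>
        (Finset.single_le_sum (fun _ _ => Nat.zero_le _) (Finset.mem_univ j)).trans hμ
    obtain ⟨φ, hφ⟩ := S.exists_norm_sub_smul_le hfin
      (fun μ => multiDeriv (multiIndexList μ) (fun X => Θ X f) 0) hε
    refine ⟨S.smul φ f, Submodule.subset_span ⟨φ, f, hf, rfl⟩, fun μ hμ => ?_⟩
    let L : B →L[ℝ] B := (ContinuousLinearMap.id ℂ B - S.smulCLM φ).restrictScalars ℝ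
    have hL : (fun X => Θ X (f - S.smul φ f)) = fun X => L (Θ X f) := by
      funext X
      rw [map_sub, hcov]
      rfl
    rw [hL, multiDeriv_clm_comp L _ hf]
    exact hφ μ hμ
  refine ⟨hfrechet, ?_⟩
  rw [← dense_closure]
  refine (dense_smoothVectors Θ hadd hzero hcont).mono fun f hf => ?_
  rw [Metric.mem_closure_iff]
  intro ε hε
  obtain ⟨g, hg, hfg⟩ := hfrechet f hf 0 (ε / 2) (half_pos hε)
  refine ⟨g, hg, ?_⟩
  have hnorm := hfg 0 (by simp)
  have hnil : multiIndexList (0 : Fin d → ℕ) = [] := by simp [multiIndexList]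
  rw [hnil, multiDeriv, hzero, ← dist_eq_norm] at hnorm
  linarith
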